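/- arXiv:1812.04916 — 3 statements merged into one kernel-verified Lean document; each statement's English description precedes it below -/
import Mathlib

section
/- Let G be a connected bipartite simple graph on n ≥ 4 vertices with vertex bipartition V = (X, Y) such that every vertex in X has degree c and every vertex in Y has degree d, and let λ₁ ≥ λ₂ ≥ … ≥ λₙ be its adjacency eigenvalues. Then √( 2(|E| − c·d) / ((n−2)(n−3)) ) ≤ λ₂ ≤ √( 2(n−3)(|E| − c·d) / (n−2) ), where |E| is the number of edges of G. -/
set_option autoImplicit false

open Matrix Polynomial

/-- If a finite family of reals sums to zero, its maximum is controlled from both sides by the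
sum of squares. -/
lemma Finset.max_sq_bounds_of_sum_eq_zero {ι : Type*} [DecidableEq ι] {s : Finset ι}
    {x : ι → ℝ} {i₀ : ι} (hi₀ : i₀ ∈ s) (hmax : ∀ i ∈ s, x i ≤ x i₀) (hsum : ∑ i ∈ s, x i = 0) :
    0 ≤ x i₀ ∧ ∑ i ∈ s, x i ^ 2 ≤ s.card * (s.card - 1) * x i₀ ^ 2 ∧
      s.card * x i₀ ^ 2 ≤ (s.card - 1) * ∑ i ∈ s, x i ^ 2 := by
  have hcard (i : ι) (hi : i ∈ s) : ((s.erase i).card : ℝ) = s.card - 1 := by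
    rw [Finset.cast_card_erase_of_mem hi]
  refine ⟨?_, ?_, ?_⟩
  · by_contra! h
    have := Finset.sum_neg (fun i hi => (hmax i hi).trans_lt h) ⟨i₀, hi₀⟩
    linarith
  · have hlow (i : ι) (hi : i ∈ s) : 0 ≤ x i + (s.card - 1) * x i₀ := by
      have h₁ := Finset.sum_le_card_nsmul (s.erase i) x (x i₀)
        fun j hj => hmax j (Finset.mem_of_mem_erase hj)
      rw [nsmul_eq_mul, hcard i hi] at h₁
      have h₂ := Finset.add_sum_erase s x hi
      linarith
    have hprod : 0 ≤ ∑ i ∈ s, (x i₀ - x i) * (x i + (s.card - 1) * x i₀) :=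
      Finset.sum_nonneg fun i hi => mul_nonneg (sub_nonneg.2 (hmax i hi)) (hlow i hi)
    have hexpand : ∑ i ∈ s, (x i₀ - x i) * (x i + (s.card - 1) * x i₀) =
        s.card * (s.card - 1) * x i₀ ^ 2 + (x i₀ - (s.card - 1) * x i₀) * ∑ i ∈ s, x i
          - ∑ i ∈ s, x i ^ 2 := by
      rw [Finset.mul_sum, ← sub_eq_zero, mul_assoc, ← nsmul_eq_mul, ← Finset.sum_const,
        ← Finset.sum_add_distrib, ← Finset.sum_sub_distrib, ← Finset.sum_sub_distrib]
      exact Finset.sum_eq_zero fun i _ => by ring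
    rw [hexpand, hsum] at hprod
    linarith
  · have hcs := sq_sum_le_card_mul_sum_sq (s := s.erase i₀) (f := x)
    rw [hcard i₀ hi₀] at hcs
    have h₁ := Finset.add_sum_erase s x hi₀
    have h₂ := Finset.add_sum_erase s (fun i => x i ^ 2) hi₀
    rw [show ∑ i ∈ s.erase i₀, x i = -x i₀ by linarith] at hcs
    rw [← h₂]
    linarith

lemma Matrix.IsHermitian.trace_mul_self_eq_sum_eigenvalues_sq {m : Type*} [Fintype m]
    [DecidableEq m] {A : Matrix m m ℝ} (hA : A.IsHermitian) :
    (A * A).trace = ∑ i, hA.eigenvalues i ^ 2 := by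
  conv_lhs => rw [hA.spectral_theorem, ← map_mul, Unitary.conjStarAlgAut_apply,
    Matrix.trace_mul_comm, ← mul_assoc]
  simp [Matrix.trace, pow_two]

lemma Matrix.isRoot_charpoly_iff_exists_mulVec_eq {m K : Type*} [Fintype m] [DecidableEq m]
    [Field K] {A : Matrix m m K} {r : K} :
    A.charpoly.IsRoot r ↔ ∃ v ≠ 0, A *ᵥ v = r • v := by
  rw [Polynomial.IsRoot, Matrix.eval_charpoly, ← Matrix.exists_mulVec_eq_zero_iff]
  refine exists_congr fun v => and_congr_right fun _ => ?_
  rw [Matrix.sub_mulVec, sub_eq_zero, Matrix.scalar_apply, ← Matrix.smul_one_eq_diagonal,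
    Matrix.smul_mulVec, Matrix.one_mulVec, eq_comm]

namespace SimpleGraph

variable {V : Type*} [Fintype V] {G : SimpleGraph V} [DecidableRel G.Adj]

/-- If the degrees of the two ends of each edge have product at most `K`, then the square of each
adjacency eigenvalue is at most `K`. -/
lemma sq_le_of_adjMatrix_mulVec_eq {K : ℕ} (hK : ∀ i j, G.Adj i j → G.degree i * G.degree j ≤ K)
    {r : ℝ} {v : V → ℝ} (hv : v ≠ 0) (h : G.adjMatrix ℝ *ᵥ v = r • v) : r ^ 2 ≤ K := by
  obtain ⟨j, hj⟩ := Function.ne_iff.1 hv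
  obtain ⟨i, -, hi⟩ := Finset.exists_max_image Finset.univ (fun k => |v k|) ⟨j, Finset.mem_univ j⟩
  have hpos : 0 < |v i| := (abs_pos.2 hj).trans_le (hi j (Finset.mem_univ j))
  have happ (k : V) : ∑ u ∈ G.neighborFinset k, v u = r * v k := by
    simpa using congrFun h k
  have hnbr (k : V) : |r| * |v k| ≤ G.degree k * |v i| := by
    rw [← abs_mul, ← happ]
    refine (Finset.abs_sum_le_sum_abs _ _).trans ?_
    refine (Finset.sum_le_card_nsmul _ _ _ fun u _ => hi u (Finset.mem_univ u)).trans_eq ?_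
    simp
  have hle : r ^ 2 * |v i| ≤ K * |v i| := by
    calc r ^ 2 * |v i| = |r| * |∑ u ∈ G.neighborFinset i, v u| := by
          rw [happ, abs_mul, ← sq_abs]; ring
      _ ≤ |r| * ∑ u ∈ G.neighborFinset i, |v u| := by
          gcongr
          exact Finset.abs_sum_le_sum_abs _ _
      _ = ∑ u ∈ G.neighborFinset i, |r| * |v u| := Finset.mul_sum _ _ _
      _ ≤ ∑ u ∈ G.neighborFinset i, (G.degree u : ℝ) * |v i| :=
          Finset.sum_le_sum fun u _ => hnbr u
      _ ≤ K * |v i| := by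
          rw [← Finset.sum_mul]
          gcongr
          rcases (G.neighborFinset i).eq_empty_or_nonempty with he | hne
          · simp [he]
          · obtain ⟨w, hw, hwmax⟩ := Finset.exists_max_image _ (fun u => G.degree u) hne
            refine (Finset.sum_le_card_nsmul _ _ (G.degree w : ℝ)
              fun u hu => by exact_mod_cast hwmax u hu).trans ?_
            rw [card_neighborFinset_eq_degree, nsmul_eq_mul]
            exact_mod_cast hK i w ((G.mem_neighborFinset i w).1 hw)
  exact le_of_mul_le_mul_right hle hpos

/-- The vector equal to `a` on one side and `b` on the other side of a biregular bipartite graph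
is an eigenvector of the adjacency matrix as soon as `c * b = r * a` and `d * a = r * b`. -/
lemma adjMatrix_mulVec_biregular {c d : ℕ} {S T : Set V} [DecidablePred (· ∈ S)]
    (hdisj : Disjoint S T) (hcover : ∀ v, v ∈ S ∨ v ∈ T)
    (hbip : ∀ i j, G.Adj i j → (i ∈ S ∧ j ∈ T) ∨ (i ∈ T ∧ j ∈ S))
    (hS : ∀ i ∈ S, G.degree i = c) (hT : ∀ i ∈ T, G.degree i = d)
    {a b r : ℝ} (ha : c * b = r * a) (hb : d * a = r * b) :
    G.adjMatrix ℝ *ᵥ (fun i => if i ∈ S then a else b) =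
      r • fun i => if i ∈ S then a else b := by
  have hnot (i : V) (hi : i ∈ T) : i ∉ S := fun h => Set.disjoint_left.1 hdisj h hi
  ext i
  rw [adjMatrix_mulVec_apply, Pi.smul_apply, smul_eq_mul]
  rcases hcover i with hi | hi
  · have hnbr : ∀ u ∈ G.neighborFinset i, (if u ∈ S then a else b) = b := fun u hu => by
      rcases hbip i u ((G.mem_neighborFinset i u).1 hu) with h | h
      · exact if_neg (hnot u h.2)
      · exact absurd hi (hnot i h.1)
    rw [Finset.sum_congr rfl hnbr, if_pos hi, ← ha, ← hS i hi]
    simp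
  · have hnbr : ∀ u ∈ G.neighborFinset i, (if u ∈ S then a else b) = a := fun u hu => by
      rcases hbip i u ((G.mem_neighborFinset i u).1 hu) with h | h
      · exact absurd h.1 (hnot i hi)
      · exact if_pos h.2
    rw [Finset.sum_congr rfl hnbr, if_neg (hnot i hi), ← hb, ← hT i hi]
    simp

end SimpleGraph

/-- Bounds for the second largest adjacency eigenvalue of a connected
`(c,d)`-biregular bipartite graph on `n ≥ 4` vertices with bipartition `(S, T)`. The
adjacency eigenvalues, in decreasing order with multiplicity, are encoded by the antitone
function `μ` through the factorization of the characteristic polynomial. -/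
theorem stmt_6 {n c d : ℕ} (hn : 4 ≤ n) (G : SimpleGraph (Fin n)) [DecidableRel G.Adj]
    (hconn : G.Connected) (S T : Set (Fin n))
    (hdisj : Disjoint S T) (hcover : ∀ v, v ∈ S ∨ v ∈ T)
    (hbip : ∀ i j, G.Adj i j → (i ∈ S ∧ j ∈ T) ∨ (i ∈ T ∧ j ∈ S))
    (hS : ∀ i ∈ S, G.degree i = c) (hT : ∀ i ∈ T, G.degree i = d)
    (μ : Fin n → ℝ) (hanti : Antitone μ)
    (hchar : (G.adjMatrix ℝ).charpoly = ∏ i, (Polynomial.X - Polynomial.C (μ i))) :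
    Real.sqrt (2 * ((G.edgeFinset.card : ℝ) - c * d) / (((n : ℝ) - 2) * ((n : ℝ) - 3)))
        ≤ μ ⟨1, by omega⟩ ∧
      μ ⟨1, by omega⟩ ≤
        Real.sqrt (2 * ((n : ℝ) - 3) * ((G.edgeFinset.card : ℝ) - c * d) / ((n : ℝ) - 2)) := by
  classical
  have hherm : (G.adjMatrix ℝ).IsHermitian := G.isHermitian_adjMatrix ℝ
  have hroots : Finset.univ.val.map μ = Finset.univ.val.map hherm.eigenvalues := by
    have h := hherm.roots_charpoly_eq_eigenvalues
    rw [hchar, Polynomial.roots_prod _ _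
      (Finset.prod_ne_zero_iff.2 fun i _ => Polynomial.X_sub_C_ne_zero _)] at h
    simpa using h
  have hsum : ∑ i, μ i = 0 := by
    have h := congrArg Multiset.sum hroots
    have htr := hherm.trace_eq_sum_eigenvalues
    rw [SimpleGraph.trace_adjMatrix] at htr
    exact h.trans htr.symm
  have hsq : ∑ i, μ i ^ 2 = 2 * G.edgeFinset.card := by
    have h : ∑ i, μ i ^ 2 = ∑ i, hherm.eigenvalues i ^ 2 := by
      have h := congrArg (fun m : Multiset ℝ => (m.map (· ^ 2)).sum) hroots
      simp only [Multiset.map_map] at h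
      exact h
    rw [h, ← hherm.trace_mul_self_eq_sum_eigenvalues_sq, Matrix.trace]
    simp_rw [Matrix.diag_apply, SimpleGraph.adjMatrix_mul_self_apply_self]
    exact_mod_cast G.sum_degrees_eq_twice_card_edges
  have hroot (r : ℝ) : (∃ i, μ i = r) ↔ ∃ v ≠ 0, G.adjMatrix ℝ *ᵥ v = r • v := by
    rw [← Matrix.isRoot_charpoly_iff_exists_mulVec_eq, hchar, Polynomial.IsRoot,
      Polynomial.eval_prod, Finset.prod_eq_zero_iff]
    simp [sub_eq_zero, eq_comm]
  have hle (i : Fin n) : μ i ^ 2 ≤ c * d := by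
    obtain ⟨v, hv, h⟩ := (hroot (μ i)).1 ⟨i, rfl⟩
    refine mod_cast SimpleGraph.sq_le_of_adjMatrix_mulVec_eq (K := c * d)
      (fun i j hij => ?_) hv h
    rcases hbip i j hij with ⟨hi, hj⟩ | ⟨hi, hj⟩
    · rw [hS i hi, hT j hj]
    · rw [hT i hi, hS j hj, mul_comm]
  have hpos : 0 < c ∧ 0 < d := by
    have : Nontrivial (Fin n) := Fin.nontrivial_iff_two_le.2 (by omega)
    have hdeg := hconn.preconnected.degree_pos_of_nontrivial
    obtain ⟨w, hw⟩ := (G.degree_pos_iff_exists_adj ⟨0, by omega⟩).1 (hdeg _)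
    rcases hbip _ _ hw with ⟨hi, hj⟩ | ⟨hi, hj⟩
    · exact ⟨hS _ hi ▸ hdeg _, hT _ hj ▸ hdeg _⟩
    · exact ⟨hS _ hj ▸ hdeg _, hT _ hi ▸ hdeg _⟩
  have hc : 0 < √(c : ℝ) := Real.sqrt_pos.2 (by exact_mod_cast hpos.1)
  have hd : 0 < √(d : ℝ) := Real.sqrt_pos.2 (by exact_mod_cast hpos.2)
  have hcc : √(c : ℝ) * √c = c := Real.mul_self_sqrt c.cast_nonneg
  have hdd : √(d : ℝ) * √d = d := Real.mul_self_sqrt d.cast_nonneg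
  have hprod : (√(c : ℝ) * √d) ^ 2 = c * d := by rw [mul_pow, pow_two, pow_two, hcc, hdd]
  have hattained (ε : ℝ) (hε : ε * ε = 1) : ∃ i, μ i = ε * (√c * √d) := by
    refine (hroot _).2 ⟨_, ?_, SimpleGraph.adjMatrix_mulVec_biregular (a := √c) (b := ε * √d)
      hdisj hcover hbip hS hT ?_ ?_⟩
    · refine Function.ne_iff.2 ⟨⟨0, by omega⟩, ?_⟩
      have hε₀ : ε ≠ 0 := by rintro rfl; simp at hε
      split_ifs
      · exact hc.ne'
      · exact mul_ne_zero hε₀ hd.ne'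
    · linear_combination (-ε * √(d : ℝ)) * hcc
    · linear_combination (-√(c : ℝ)) * hdd - (√(c : ℝ) * √d * √d) * hε
  let first : Fin n := ⟨0, by omega⟩
  let second : Fin n := ⟨1, by omega⟩
  let last : Fin n := ⟨n - 1, by omega⟩
  have hfirst : μ first = √c * √d := by
    obtain ⟨i, hi⟩ := hattained 1 (by norm_num)
    refine le_antisymm (abs_le_of_sq_le_sq' (hprod ▸ hle first) (by positivity)).2 ?_
    rw [← one_mul (√(c : ℝ) * √d), ← hi]
    exact hanti (Fin.mk_le_of_le_val (Nat.zero_le _))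
  have hlast : μ last = -(√c * √d) := by
    obtain ⟨i, hi⟩ := hattained (-1) (by norm_num)
    refine le_antisymm ?_ (abs_le_of_sq_le_sq' (hprod ▸ hle last) (by positivity)).1
    rw [← neg_one_mul (√(c : ℝ) * √d), ← hi]
    exact hanti (Fin.le_def.2 (by simp only [last]; omega))
  have hne : last ≠ first := by simp only [first, last, ne_eq, Fin.mk.injEq]; omega
  have hmem : last ∈ Finset.univ.erase first := by simp [hne]
  set s : Finset (Fin n) := (Finset.univ.erase first).erase last with hs
  have hsplit (f : Fin n → ℝ) : f first + (f last + ∑ i ∈ s, f i) = ∑ i, f i := by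
    rw [hs, Finset.add_sum_erase _ _ hmem, Finset.add_sum_erase _ _ (Finset.mem_univ _)]
  have hcard : (s.card : ℝ) = n - 2 := by
    rw [hs, Finset.cast_card_erase_of_mem hmem,
      Finset.cast_card_erase_of_mem (Finset.mem_univ _), Finset.card_univ, Fintype.card_fin]
    ring
  have hsecond : second ∈ s := by
    refine Finset.mem_erase.2 ⟨Fin.ne_of_val_ne ?_, Finset.mem_erase.2
      ⟨Fin.ne_of_val_ne ?_, Finset.mem_univ _⟩⟩ <;> simp only [first, second, last] <;> omega
  have hmax : ∀ i ∈ s, μ i ≤ μ second := fun i hi => by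
    simp only [hs, first, last, Finset.mem_erase, ne_eq, Fin.ext_iff] at hi
    exact hanti (Fin.le_def.2 (by simp only [second]; omega))
  have hsum_s : ∑ i ∈ s, μ i = 0 := by
    have := hsplit μ
    rw [hfirst, hlast, hsum] at this
    linarith
  have hsq_s : ∑ i ∈ s, μ i ^ 2 = 2 * ((G.edgeFinset.card : ℝ) - c * d) := by
    have := hsplit fun i => μ i ^ 2
    simp only [hfirst, hlast, neg_sq, hprod, hsq] at this
    linarith
  obtain ⟨h₀, hlower, hupper⟩ := Finset.max_sq_bounds_of_sum_eq_zero hsecond hmax hsum_s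
  rw [hsq_s, hcard] at hlower hupper
  have hn' : (4 : ℝ) ≤ n := by exact_mod_cast hn
  constructor
  · refine Real.sqrt_le_iff.2 ⟨h₀, (div_le_iff₀ (mul_pos (by linarith) (by linarith))).2 ?_⟩
    linarith
  · refine Real.le_sqrt_of_sq_le ((le_div_iff₀ (by linarith)).2 ?_)
    linarith
end

section
/- Let G be a connected simple graph on n vertices possessing a dominating vertex i (i.e., d_i = n−1), and let λ₁ ≥ λ₂ ≥ … ≥ λₙ be the eigenvalues of the normalized adjacency matrix 𝒜 = D⁻¹A. Then −2 − 2/(n−1) + min_{k ≠ i} ( 1/d_k + 2d_k/(n−1) ) ≤ λₙ ≤ λ₂ ≤ 2 − min_{k ≠ i} ( 1/d_k + 2d_k/(n−1) ). -/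
set_option autoImplicit false

open Matrix Polynomial

/-- The normalized adjacency matrix `𝒜 = D⁻¹ A` of a graph, with entries
`a_{ij} / d_i`. -/
noncomputable def normAdj {n : ℕ} (G : SimpleGraph (Fin n)) [DecidableRel G.Adj] :
    Matrix (Fin n) (Fin n) ℝ :=
  Matrix.of fun i j => (if G.Adj i j then (1 : ℝ) else 0) / (G.degree i : ℝ)

/-- The matrix induced by `P` on the quotient by the constant vectors, in the basis given by the
classes of the standard vectors other than the `i`-th one. -/
def constQuotient {m R : Type*} [CommRing R] (P : Matrix m m R) (i : m) :
    Matrix {k // ¬k = i} {k // ¬k = i} R :=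
  Matrix.of fun k j => P k.1 j.1 - P i j.1

/-- If all row sums of `P` are `1`, the characteristic polynomial of `P` splits off the factor
`X - 1` corresponding to the constant vectors. -/
theorem charpoly_eq_mul_charpoly_constQuotient {m R : Type*} [Fintype m] [DecidableEq m]
    [CommRing R] (P : Matrix m m R) (i : m) (hP : ∀ k, ∑ j, P k j = 1) :
    P.charpoly = (X - C 1) * (constQuotient P i).charpoly := by
  set S : Matrix m m R := (1 : Matrix m m R).updateCol i 1 with hS
  set M : Matrix m m R := Matrix.of fun k j =>
    if j = i then (if k = i then 1 else 0) else if k = i then P i j else P k j - P i j with hM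
  have hdet : S.det = 1 := by
    rw [hS, ← cramer_apply, cramer_one]
    rfl
  have hPS : P * S = S * M := by
    have hSe : ∀ k l, S k l = (if l = i then 1 else if k = l then 1 else 0) := by
      intro k l
      simp [hS, Matrix.updateCol_apply, Matrix.one_apply]
    ext k j
    have hl : (P * S) k j = if j = i then 1 else P k j := by
      by_cases hj : j = i <;> simp [Matrix.mul_apply, hSe, hj, hP]
    have hr : (S * M) k j = M i j + if k = i then 0 else M k j := by
      rw [Matrix.mul_apply, Fintype.sum_eq_add_sum_subtype_ne _ i]
      congr 1
      · simp [hSe]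
      · have : ∀ l : {l // l ≠ i}, S k l.1 * M l.1 j = if k = l.1 then M k j else 0 := by
          rintro ⟨l, hli⟩
          by_cases h : k = l <;> simp [hSe, hli, h]
        simp_rw [this]
        by_cases hk : k = i
        · rw [if_pos hk]
          refine Finset.sum_eq_zero fun l _ => if_neg ?_
          rw [hk]
          exact l.2.symm
        · rw [if_neg hk, Finset.sum_eq_single (⟨k, hk⟩ : {l // l ≠ i})]
          · simp
          · intro l _ hl
            exact if_neg fun h => hl (Subtype.ext h.symm)
          · simp
    rw [hl, hr]
    by_cases hj : j = i <;> by_cases hk : k = i <;> simp [hM, hj, hk]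
  have hu : IsUnit S.det := by simp [hdet]
  have hsim : P.charpoly = M.charpoly := by
    have : P = S * M * S⁻¹ := by
      rw [← hPS, Matrix.mul_assoc, Matrix.mul_nonsing_inv S hu, Matrix.mul_one]
    rw [this, Matrix.charpoly_mul_comm, ← Matrix.mul_assoc, Matrix.nonsing_inv_mul S hu,
      Matrix.one_mul]
  rw [hsim, Matrix.charpoly, Matrix.twoBlockTriangular_det _ (fun k => k = i)]
  · congr 1
    · rw [@Matrix.det_eq_elem_of_subsingleton _ (_) (_) _ _ _ _ ⟨i, rfl⟩]
      simp [Matrix.toSquareBlockProp_def, hM]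
    · rw [Matrix.charpoly]
      congr 1
      ext1 k j
      simp [Matrix.toSquareBlockProp_def, hM, constQuotient, Matrix.charmatrix_apply,
        Matrix.diagonal_apply, k.2, j.2, Subtype.ext_iff]
  · rintro k hk j rfl
    rw [Matrix.charmatrix_apply_ne _ _ _ hk]
    simp [hM, hk]

/-- The rows of the normalized adjacency matrix of a graph without isolated vertices sum to `1`. -/
theorem sum_normAdj {n : ℕ} (G : SimpleGraph (Fin n)) [DecidableRel G.Adj] (k : Fin n)
    (hk : 0 < G.degree k) : ∑ j, normAdj G k j = 1 := by
  have h : (G.degree k : ℝ) ≠ 0 := by positivity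
  simp only [normAdj, Matrix.of_apply]
  rw [← Finset.sum_div, Finset.sum_boole, div_eq_one_iff_eq h, ← G.card_neighborFinset_eq_degree,
    G.neighborFinset_eq_filter]

/-- The Gershgorin radii of the quotient of the normalized adjacency matrix at a dominating
vertex. -/
theorem sum_norm_constQuotient_normAdj {n : ℕ} (hn : 2 ≤ n) (G : SimpleGraph (Fin n))
    [DecidableRel G.Adj] (i : Fin n) (hdom : G.degree i = n - 1) (hadj : ∀ k, k ≠ i → G.Adj i k)
    (k : {k // ¬k = i}) :
    ∑ j ∈ Finset.univ.erase k, ‖constQuotient (normAdj G) i k j‖ =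
      2 + 1 / ((n : ℝ) - 1) -
        (1 / (G.degree k.1 : ℝ) + 2 * (G.degree k.1 : ℝ) / ((n : ℝ) - 1)) := by
  obtain ⟨k, hk⟩ := k
  have hki : G.Adj k i := (hadj k hk).symm
  have hN : (0 : ℝ) < (n : ℝ) - 1 := by
    have : (2 : ℝ) ≤ n := by exact_mod_cast hn
    linarith
  have hD : (0 : ℝ) < G.degree k := by
    exact_mod_cast (G.degree_pos_iff_exists_adj k).2 ⟨i, hki⟩
  have hDN : (G.degree k : ℝ) ≤ (n : ℝ) - 1 := by
    have h := G.degree_lt_card_verts k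
    rw [Fintype.card_fin] at h
    have : (G.degree k : ℝ) + 1 ≤ n := by exact_mod_cast h
    linarith
  have hi : (G.degree i : ℝ) = (n : ℝ) - 1 := by
    rw [hdom, Nat.cast_sub (by omega), Nat.cast_one]
  set f : Fin n → ℝ := fun j =>
    1 / ((n : ℝ) - 1) + (if G.Adj k j then 1 else 0) * (1 / G.degree k - 2 / ((n : ℝ) - 1))
    with hf
  have hterm : ∀ j ∈ Finset.univ.erase (⟨k, hk⟩ : {k // ¬k = i}),
      ‖constQuotient (normAdj G) i ⟨k, hk⟩ j‖ = f j.1 := by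
    rintro ⟨j, hj⟩ -
    have hle : 1 / ((n : ℝ) - 1) ≤ 1 / G.degree k := one_div_le_one_div_of_le hD hDN
    by_cases h : G.Adj k j
    · simp only [constQuotient, normAdj, Matrix.of_apply, hadj j hj, h, if_true, hi, hf,
        Real.norm_eq_abs]
      rw [abs_of_nonneg (by linarith)]
      ring
    · simp only [constQuotient, normAdj, Matrix.of_apply, hadj j hj, h, if_true, if_false, hi, hf,
        Real.norm_eq_abs, zero_div, zero_sub, abs_neg]
      rw [abs_of_pos (by positivity)]
      ring
  have hcount : ∑ j, (if G.Adj k j then (1 : ℝ) else 0) = G.degree k := by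
    rw [Finset.sum_boole, ← G.card_neighborFinset_eq_degree, G.neighborFinset_eq_filter]
  have htot : ∑ j, f j =
      n * (1 / ((n : ℝ) - 1)) + G.degree k * (1 / G.degree k - 2 / ((n : ℝ) - 1)) := by
    simp only [hf]
    rw [Finset.sum_add_distrib, ← Finset.sum_mul, hcount]
    simp
  have hsplit : ∑ j, f j = f i + ∑ j : {j // ¬j = i}, f j.1 :=
    Fintype.sum_eq_add_sum_subtype_ne f i
  have herase := Finset.add_sum_erase Finset.univ (fun j : {j // ¬j = i} => f j.1)
    (Finset.mem_univ ⟨k, hk⟩)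
  have hfi : f i = 1 / G.degree k - 1 / ((n : ℝ) - 1) := by
    simp only [hf, hki, if_true]
    ring
  have hfk : f k = 1 / ((n : ℝ) - 1) := by simp [hf]
  rw [Finset.sum_congr rfl hterm]
  have key : ∑ j ∈ Finset.univ.erase (⟨k, hk⟩ : {k // ¬k = i}), f j.1 =
      (n * (1 / ((n : ℝ) - 1)) + G.degree k * (1 / G.degree k - 2 / ((n : ℝ) - 1)))
        - (1 / G.degree k - 1 / ((n : ℝ) - 1)) - 1 / ((n : ℝ) - 1) := by
    simp only at herase
    linarith
  rw [key]
  field_simp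
  ring

/-- Gershgorin bounds for the roots of the characteristic polynomial of the quotient of the
normalized adjacency matrix at a dominating vertex. -/
theorem exists_abs_le_of_isRoot_charpoly_constQuotient {n : ℕ} (hn : 2 ≤ n)
    (G : SimpleGraph (Fin n)) [DecidableRel G.Adj] (i : Fin n) (hdom : G.degree i = n - 1)
    (hadj : ∀ k, k ≠ i → G.Adj i k) {r : ℝ}
    (hr : (constQuotient (normAdj G) i).charpoly.IsRoot r) :
    ∃ k : {k // k ≠ i}, |r + 1 / ((n : ℝ) - 1)| ≤ 2 + 1 / ((n : ℝ) - 1) -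
        (1 / (G.degree k.1 : ℝ) + 2 * (G.degree k.1 : ℝ) / ((n : ℝ) - 1)) := by
  have hev : Module.End.HasEigenvalue (Matrix.toLin' (constQuotient (normAdj G) i)) r := by
    rwa [Module.End.hasEigenvalue_iff_isRoot_charpoly, Matrix.charpoly_toLin']
  obtain ⟨k, hk⟩ := eigenvalue_mem_ball hev
  refine ⟨k, ?_⟩
  have hi : (G.degree i : ℝ) = (n : ℝ) - 1 := by
    rw [hdom, Nat.cast_sub (by omega), Nat.cast_one]
  have hdiag : constQuotient (normAdj G) i k k = -(1 / ((n : ℝ) - 1)) := by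
    simp [constQuotient, normAdj, hadj k.1 k.2, hi]
  rwa [Metric.mem_closedBall, sum_norm_constQuotient_normAdj hn G i hdom hadj, Real.dist_eq, hdiag,
    sub_neg_eq_add] at hk

/-- For a connected graph on `n` vertices with a dominating vertex `i`
(`d_i = n - 1`), the eigenvalues of the normalized adjacency matrix (in decreasing order
with multiplicity, encoded by the antitone `μ` via the characteristic polynomial) satisfy
`-2 - 2/(n-1) + min_{k ≠ i}(1/d_k + 2 d_k/(n-1)) ≤ λₙ ≤ λ₂ ≤
  2 - min_{k ≠ i}(1/d_k + 2 d_k/(n-1))`. -/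
theorem stmt_13 {n : ℕ} (hn : 2 ≤ n) (G : SimpleGraph (Fin n)) [DecidableRel G.Adj]
    (hconn : G.Connected) (i : Fin n) (hdom : G.degree i = n - 1)
    (μ : Fin n → ℝ) (hanti : Antitone μ)
    (hchar : (normAdj G).charpoly = ∏ i, (Polynomial.X - Polynomial.C (μ i))) :
    -2 - 2 / ((n : ℝ) - 1) +
        (⨅ k : {k : Fin n // k ≠ i},
          1 / (G.degree k.1 : ℝ) + 2 * (G.degree k.1 : ℝ) / ((n : ℝ) - 1))
      ≤ μ ⟨n - 1, by omega⟩ ∧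
    μ ⟨n - 1, by omega⟩ ≤ μ ⟨1, by omega⟩ ∧
    μ ⟨1, by omega⟩ ≤
      2 - (⨅ k : {k : Fin n // k ≠ i},
          1 / (G.degree k.1 : ℝ) + 2 * (G.degree k.1 : ℝ) / ((n : ℝ) - 1)) := by
  have hadj : ∀ k, k ≠ i → G.Adj i k := by
    have h : G.degree i = Fintype.card (Fin n) - 1 := by rw [hdom, Fintype.card_fin]
    intro k hk
    have hsub : G.neighborFinset i ⊆ Finset.univ.erase i := fun j hj =>
      Finset.mem_erase.2 ⟨((G.mem_neighborFinset i j).1 hj).ne', Finset.mem_univ j⟩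
    have heq := Finset.eq_of_subset_of_card_le hsub (by
      rw [G.card_neighborFinset_eq_degree, h, Finset.card_erase_of_mem (Finset.mem_univ i),
        Finset.card_univ])
    rw [← G.mem_neighborFinset, heq]
    exact Finset.mem_erase.2 ⟨hk, Finset.mem_univ k⟩
  have hpos : ∀ k, 0 < G.degree k := by
    have : Nontrivial (Fin n) := Fin.nontrivial_iff_two_le.2 hn
    exact fun k => hconn.preconnected.degree_pos_of_nontrivial k
  have hN : (0 : ℝ) < 1 / ((n : ℝ) - 1) := by
    have : (2 : ℝ) ≤ n := by exact_mod_cast hn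
    exact one_div_pos.2 (by linarith)
  have htwo : 2 / ((n : ℝ) - 1) = 2 * (1 / ((n : ℝ) - 1)) := by ring
  set m := ⨅ k : {k : Fin n // k ≠ i},
    1 / (G.degree k.1 : ℝ) + 2 * (G.degree k.1 : ℝ) / ((n : ℝ) - 1)
  have hroot : ∀ r, (constQuotient (normAdj G) i).charpoly.IsRoot r →
      |r + 1 / ((n : ℝ) - 1)| ≤ 2 + 1 / ((n : ℝ) - 1) - m := by
    intro r hr
    obtain ⟨k, hk⟩ := exists_abs_le_of_isRoot_charpoly_constQuotient hn G i hdom hadj hr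
    have : m ≤ _ := ciInf_le (Set.finite_range _).bddBelow k
    linarith
  rw [charpoly_eq_mul_charpoly_constQuotient _ i fun k => sum_normAdj G k (hpos k)] at hchar
  obtain ⟨j, hj⟩ : ∃ j, μ j = 1 := by
    have h := congrArg (Polynomial.eval 1) hchar
    simp only [eval_mul, eval_sub, eval_X, eval_C, sub_self, zero_mul, eval_prod] at h
    obtain ⟨j, -, hj⟩ := Finset.prod_eq_zero_iff.1 h.symm
    exact ⟨j, by linarith⟩
  have hmu : ∀ k, k ≠ j → |μ k + 1 / ((n : ℝ) - 1)| ≤ 2 + 1 / ((n : ℝ) - 1) - m := by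
    intro k hk
    refine hroot _ ?_
    rw [← Finset.mul_prod_erase _ _ (Finset.mem_univ j), hj] at hchar
    rw [mul_left_cancel₀ (X_sub_C_ne_zero 1) hchar, IsRoot, eval_prod]
    exact Finset.prod_eq_zero (Finset.mem_erase.2 ⟨hk, Finset.mem_univ k⟩) (by simp)
  have h01 : (⟨0, by omega⟩ : Fin n) ≤ ⟨1, by omega⟩ := by simp
  obtain ⟨k, hk, hk1⟩ : ∃ k, k ≠ j ∧ k ≤ ⟨1, by omega⟩ := by
    by_cases h : (⟨1, by omega⟩ : Fin n) = j
    · exact ⟨⟨0, by omega⟩, by simp [← h], h01⟩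
    · exact ⟨_, h, le_rfl⟩
  have hbk := hmu k hk
  refine ⟨?_, hanti (Fin.mk_le_mk.2 (by omega)), ?_⟩
  · by_cases h : (⟨n - 1, by omega⟩ : Fin n) = j
    · rw [h, hj]
      linarith [abs_nonneg (μ k + 1 / ((n : ℝ) - 1))]
    · linarith [(abs_le.1 (hmu _ h)).1]
  · linarith [hanti hk1, (abs_le.1 hbk).2]
end

section
/- Let G be a connected simple graph on n vertices with Laplacian eigenvalues λ₁ ≥ λ₂ ≥ … ≥ λ_{n−1} ≥ λₙ = 0, and let Δ = (Σᵢ dᵢ)/n be the average degree. Then (n/(n−1))Δ − √( ((n−2)/(n−1)) [ Σᵢ dᵢ² + nΔ − n²Δ²/(n−1) ] ) ≤ λ_{n−1} ≤ (n/(n−1))Δ − √( ( Σᵢ dᵢ² + nΔ − n²Δ²/(n−1) ) / ((n−1)(n−2)) ), and (n/(n−1))Δ + √( ( Σᵢ dᵢ² + nΔ − n²Δ²/(n−1) ) / ((n−1)(n−2)) ) ≤ λ₁ ≤ (n/(n−1))Δ + √( ((n−2)/(n−1)) [ Σᵢ dᵢ² + nΔ − n²Δ²/(n−1) ] ). -/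
set_option autoImplicit false

open Matrix Polynomial

/-- The average degree `Δ = (∑ i, d_i)/n` of a graph, as a real number. -/
noncomputable def avgDeg {n : ℕ} (G : SimpleGraph (Fin n)) [DecidableRel G.Adj] : ℝ :=
  (∑ i, (G.degree i : ℝ)) / n

/-- The quantity `∑ i, d_i² + nΔ - n²Δ²/(n-1)` appearing in the Laplacian eigenvalue
bounds. -/
noncomputable def lapT {n : ℕ} (G : SimpleGraph (Fin n)) [DecidableRel G.Adj] : ℝ :=
  (∑ i, (G.degree i : ℝ) ^ 2) + (n : ℝ) * avgDeg G -
    (n : ℝ) ^ 2 * (avgDeg G) ^ 2 / ((n : ℝ) - 1)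

/-- Samuelson's inequality: a bound on one entry of a family of reals summing to zero. -/
theorem card_mul_sq_le_of_sum_eq_zero {ι : Type*} [Fintype ι] (y : ι → ℝ)
    (h0 : ∑ i, y i = 0) (i : ι) :
    (Fintype.card ι : ℝ) * y i ^ 2 ≤ ((Fintype.card ι : ℝ) - 1) * ∑ j, y j ^ 2 := by
  classical
  have h1 := Finset.add_sum_erase Finset.univ y (Finset.mem_univ i)
  have h2 := Finset.add_sum_erase Finset.univ (fun j => y j ^ 2) (Finset.mem_univ i)
  have h3 := sq_sum_le_card_mul_sum_sq (s := Finset.univ.erase i) (f := y)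
  have hcard : ((Finset.univ.erase i).card : ℝ) = (Fintype.card ι : ℝ) - 1 := by
    rw [Finset.cast_card_erase_of_mem (Finset.mem_univ i), Finset.card_univ]
  have h4 : ∑ j ∈ Finset.univ.erase i, y j = -y i := by linarith
  rw [hcard, h4] at h3
  rw [← h2]
  linarith

/-- A family of reals summing to zero and bounded above by `M` has sum of squares at most
`N (N - 1) M²`, where `N` is the number of entries. -/
theorem sum_sq_le_of_sum_eq_zero_of_le {ι : Type*} [Fintype ι] (y : ι → ℝ)
    (h0 : ∑ i, y i = 0) {M : ℝ} (hM : ∀ i, y i ≤ M) :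
    ∑ j, y j ^ 2 ≤ M ^ 2 * ((Fintype.card ι : ℝ) * ((Fintype.card ι : ℝ) - 1)) := by
  classical
  have hlow : ∀ i, 0 ≤ y i + ((Fintype.card ι : ℝ) - 1) * M := by
    intro i
    have h1 := Finset.add_sum_erase Finset.univ y (Finset.mem_univ i)
    have h3 := Finset.sum_le_card_nsmul (Finset.univ.erase i) y M (fun j _ => hM j)
    rw [nsmul_eq_mul, Finset.cast_card_erase_of_mem (Finset.mem_univ i), Finset.card_univ] at h3
    linarith
  have hsum : 0 ≤ ∑ i, (M - y i) * (y i + ((Fintype.card ι : ℝ) - 1) * M) :=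
    Finset.sum_nonneg fun i _ => mul_nonneg (sub_nonneg.2 (hM i)) (hlow i)
  have hexp : ∑ i, (M - y i) * (y i + ((Fintype.card ι : ℝ) - 1) * M) =
      (M - ((Fintype.card ι : ℝ) - 1) * M) * ∑ i, y i - ∑ i, y i ^ 2 +
        (Fintype.card ι : ℝ) * (((Fintype.card ι : ℝ) - 1) * M ^ 2) := by
    rw [Finset.mul_sum, ← Finset.sum_sub_distrib, ← nsmul_eq_mul, ← Finset.card_univ,
      ← Finset.sum_const, ← Finset.sum_add_distrib]
    exact Finset.sum_congr rfl fun i _ => by ring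
  rw [hexp, h0] at hsum
  linarith

/-- Each entry of a family of reals summing to zero is bounded by its spread. -/
theorem abs_le_sqrt_of_sum_eq_zero {ι : Type*} [Fintype ι] (y : ι → ℝ)
    (h0 : ∑ i, y i = 0) (i : ι) :
    |y i| ≤ √(((Fintype.card ι : ℝ) - 1) / (Fintype.card ι : ℝ) * ∑ j, y j ^ 2) := by
  have : Nonempty ι := ⟨i⟩
  have hpos : (0 : ℝ) < Fintype.card ι := by exact_mod_cast Fintype.card_pos
  refine Real.abs_le_sqrt ?_
  rw [div_mul_eq_mul_div, le_div_iff₀ hpos, mul_comm]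
  exact card_mul_sq_le_of_sum_eq_zero y h0 i

/-- An upper bound for a family of reals summing to zero is at least a multiple of its spread. -/
theorem sqrt_le_of_sum_eq_zero_of_le {ι : Type*} [Fintype ι] [Nonempty ι] (y : ι → ℝ)
    (h0 : ∑ i, y i = 0) {M : ℝ} (hM : ∀ i, y i ≤ M) :
    √((∑ j, y j ^ 2) / ((Fintype.card ι : ℝ) * ((Fintype.card ι : ℝ) - 1))) ≤ M := by
  have hcard : (1 : ℝ) ≤ Fintype.card ι := by exact_mod_cast Fintype.card_pos
  have hM0 : 0 ≤ M := by
    have h := Finset.sum_le_card_nsmul Finset.univ y M (fun j _ => hM j)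
    rw [h0, nsmul_eq_mul, Finset.card_univ] at h
    exact nonneg_of_mul_nonneg_right h (by linarith)
  refine Real.sqrt_le_iff.2 ⟨hM0, div_le_of_le_mul₀ ?_ (sq_nonneg M) ?_⟩
  · exact mul_nonneg (by linarith) (by linarith)
  · exact sum_sq_le_of_sum_eq_zero_of_le y h0 hM

/-- The trace of the square of a real symmetric matrix is the sum of its squared eigenvalues. -/
theorem Matrix.IsHermitian.trace_mul_self_eq_sum_sq_eigenvalues {ι : Type*} [Fintype ι]
    [DecidableEq ι] {A : Matrix ι ι ℝ} (hA : A.IsHermitian) :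
    (A * A).trace = ∑ i, hA.eigenvalues i ^ 2 := by
  conv_lhs => rw [hA.spectral_theorem, ← map_mul, Unitary.conjStarAlgAut_apply,
    Matrix.trace_mul_comm, ← mul_assoc, Unitary.coe_star_mul_self, one_mul,
    Matrix.diagonal_mul_diagonal, Matrix.trace_diagonal]
  simp [pow_two]

theorem Polynomial.map_univ_eq_of_prod_X_sub_C_eq {ι R : Type*} [Fintype ι] [CommRing R]
    [IsDomain R] {f g : ι → R} (h : ∏ i, (X - C (f i)) = ∏ i, (X - C (g i))) :
    Finset.univ.val.map f = Finset.univ.val.map g := by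
  have key (f : ι → R) : (∏ i, (X - C (f i))).roots = Finset.univ.val.map f := by
    rw [← Polynomial.roots_multiset_prod_X_sub_C (Finset.univ.val.map f), Multiset.map_map]
    rfl
  rw [← key f, h, key g]

theorem SimpleGraph.trace_lapMatrix {V : Type*} [Fintype V] [DecidableEq V] (G : SimpleGraph V)
    [DecidableRel G.Adj] : (G.lapMatrix ℝ).trace = ∑ i, (G.degree i : ℝ) := by
  rw [SimpleGraph.lapMatrix, Matrix.trace_sub, SimpleGraph.trace_adjMatrix, sub_zero,
    SimpleGraph.degMatrix, Matrix.trace_diagonal]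

theorem SimpleGraph.trace_lapMatrix_mul_self {V : Type*} [Fintype V] [DecidableEq V]
    (G : SimpleGraph V) [DecidableRel G.Adj] :
    (G.lapMatrix ℝ * G.lapMatrix ℝ).trace =
      ∑ i, (G.degree i : ℝ) ^ 2 + ∑ i, (G.degree i : ℝ) := by
  rw [← Finset.sum_add_distrib, Matrix.trace]
  refine Finset.sum_congr rfl fun i _ => ?_
  rw [Matrix.diag_apply, SimpleGraph.lapMatrix, SimpleGraph.degMatrix, sub_mul, mul_sub, mul_sub]
  simp only [Matrix.sub_apply, Matrix.diagonal_mul, Matrix.mul_diagonal,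
    SimpleGraph.adjMatrix_mul_self_apply_self, Matrix.diagonal_apply_eq,
    SimpleGraph.adjMatrix_apply, SimpleGraph.irrefl, if_false]
  ring

/-- Bounds on the largest Laplacian eigenvalue `λ₁` and the algebraic
connectivity `λ_{n-1}` of a connected graph on `n` vertices, in terms of the average
degree `Δ` and the degree sequence. The Laplacian eigenvalues, in decreasing order with
multiplicity, are encoded by the antitone function `μ` through the factorization of the
characteristic polynomial. -/
theorem stmt_16 {n : ℕ} (hn : 2 ≤ n) (G : SimpleGraph (Fin n)) [DecidableRel G.Adj]
    (hconn : G.Connected)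
    (μ : Fin n → ℝ) (hanti : Antitone μ)
    (hchar : (G.lapMatrix ℝ).charpoly = ∏ i, (Polynomial.X - Polynomial.C (μ i))) :
    ((n : ℝ) / ((n : ℝ) - 1)) * avgDeg G -
          Real.sqrt ((((n : ℝ) - 2) / ((n : ℝ) - 1)) * lapT G)
        ≤ μ ⟨n - 2, by omega⟩ ∧
      μ ⟨n - 2, by omega⟩ ≤
        ((n : ℝ) / ((n : ℝ) - 1)) * avgDeg G -
          Real.sqrt (lapT G / (((n : ℝ) - 1) * ((n : ℝ) - 2))) ∧
    ((n : ℝ) / ((n : ℝ) - 1)) * avgDeg G +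
          Real.sqrt (lapT G / (((n : ℝ) - 1) * ((n : ℝ) - 2)))
        ≤ μ ⟨0, by omega⟩ ∧
      μ ⟨0, by omega⟩ ≤
        ((n : ℝ) / ((n : ℝ) - 1)) * avgDeg G +
          Real.sqrt ((((n : ℝ) - 2) / ((n : ℝ) - 1)) * lapT G) := by
  obtain ⟨m, rfl⟩ : ∃ m, n = m + 2 := ⟨n - 2, by omega⟩
  have hA := G.isHermitian_lapMatrix ℝ
  have hmap : Finset.univ.val.map μ = Finset.univ.val.map hA.eigenvalues :=
    Polynomial.map_univ_eq_of_prod_X_sub_C_eq (hchar.symm.trans hA.charpoly_eq)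
  have htransfer (f : ℝ → ℝ) : ∑ i, f (μ i) = ∑ i, f (hA.eigenvalues i) := by
    have h := congrArg (fun s => (s.map f).sum) hmap
    rwa [Multiset.map_map, Multiset.map_map] at h
  have hsum : ∑ i, μ i = ∑ i, (G.degree i : ℝ) := by
    rw [← G.trace_lapMatrix, hA.trace_eq_sum_eigenvalues]
    exact htransfer id
  have hsq : ∑ i, μ i ^ 2 = ∑ i, (G.degree i : ℝ) ^ 2 + ∑ i, (G.degree i : ℝ) := by
    rw [← G.trace_lapMatrix_mul_self, hA.trace_mul_self_eq_sum_sq_eigenvalues]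
    exact htransfer (· ^ 2)
  have hnonneg (i) : 0 ≤ μ i := by
    have h : μ i ∈ Finset.univ.val.map hA.eigenvalues :=
      hmap ▸ Multiset.mem_map_of_mem μ (Finset.mem_univ_val i)
    obtain ⟨j, -, hj⟩ := Multiset.mem_map.1 h
    exact hj ▸ (SimpleGraph.posSemidef_lapMatrix ℝ G).eigenvalues_nonneg j
  have hlast : μ (Fin.last (m + 1)) = 0 := by
    have hdet := G.det_lapMatrix_eq_zero
    rw [hA.det_eq_prod_eigenvalues, Finset.prod_eq_zero_iff] at hdet
    obtain ⟨j, -, hj⟩ := hdet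
    have h : hA.eigenvalues j ∈ Finset.univ.val.map μ :=
      hmap ▸ Multiset.mem_map_of_mem _ (Finset.mem_univ_val j)
    obtain ⟨i, -, hi⟩ := Multiset.mem_map.1 h
    have hi0 : μ i = 0 := hi.trans hj
    exact le_antisymm (hi0 ▸ hanti (Fin.le_last i)) (hnonneg _)
  rw [Fin.sum_univ_castSucc, hlast] at hsum hsq
  set a : ℝ := ((m + 2 : ℕ) : ℝ) / (((m + 2 : ℕ) : ℝ) - 1) * avgDeg G with ha
  have hm : ((m : ℝ) + 1) ≠ 0 := by positivity
  have hm2 : ((m : ℝ) + 2) ≠ 0 := by positivity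
  have hdeg : ∑ i, (G.degree i : ℝ) = (m + 1) * a := by
    rw [ha, avgDeg]
    push_cast
    rw [show (m : ℝ) + 2 - 1 = m + 1 by ring]
    field_simp
  have hT : lapT G = ∑ i, (G.degree i : ℝ) ^ 2 + (m + 1) * a - (m + 1) * a ^ 2 := by
    have havg : avgDeg G = (m + 1) * a / (m + 2) := by
      rw [avgDeg, hdeg]
      push_cast
      rfl
    rw [lapT, havg]
    push_cast
    rw [show (m : ℝ) + 2 - 1 = m + 1 by ring]
    field_simp
  let y : Fin (m + 1) → ℝ := fun i => μ i.castSucc - a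
  have hy0 : ∑ i, y i = 0 := by
    simp only [y, Finset.sum_sub_distrib, Finset.sum_const, Finset.card_univ, Fintype.card_fin,
      nsmul_eq_mul]
    push_cast
    linarith
  have hy2 : ∑ i, y i ^ 2 = lapT G := by
    simp only [y, sub_sq, Finset.sum_sub_distrib, Finset.sum_add_distrib, Finset.sum_const,
      Finset.card_univ, Fintype.card_fin, nsmul_eq_mul, ← Finset.sum_mul, ← Finset.mul_sum]
    rw [hT]
    push_cast
    have h1 : ∑ i : Fin (m + 1), μ i.castSucc = (m + 1) * a := by linarith
    rw [h1]
    linarith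
  have hcard : ((Fintype.card (Fin (m + 1)) : ℕ) : ℝ) = ((m + 2 : ℕ) : ℝ) - 1 := by
    rw [Fintype.card_fin]
    push_cast
    ring
  have hcard' : ((m + 2 : ℕ) : ℝ) - 1 - 1 = ((m + 2 : ℕ) : ℝ) - 2 := by ring
  have habs := abs_le_sqrt_of_sum_eq_zero y hy0
  have hmax := sqrt_le_of_sum_eq_zero_of_le y hy0 (M := y 0)
    fun i => sub_le_sub_right (hanti (Fin.castSucc_le_castSucc_iff.2 (Fin.zero_le i))) a
  have hmin := sqrt_le_of_sum_eq_zero_of_le (fun i => -y i) (by simp [hy0])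
    (M := -y (Fin.last m))
    fun i => neg_le_neg
      (sub_le_sub_right (hanti (Fin.castSucc_le_castSucc_iff.2 (Fin.le_last i))) a)
  simp only [neg_sq] at hmin
  rw [hy2, hcard, hcard'] at hmax hmin
  simp only [hy2, hcard, hcard'] at habs
  have hbot := (abs_le.1 (habs (Fin.last m))).1
  have htop := (abs_le.1 (habs 0)).2
  change _ ≤ μ (Fin.last m).castSucc - a at hbot
  change _ ≤ -(μ (Fin.last m).castSucc - a) at hmin
  change μ 0 - a ≤ _ at htop
  change _ ≤ μ 0 - a at hmax
  have hidx : (⟨m + 2 - 2, by omega⟩ : Fin (m + 2)) = (Fin.last m).castSucc := rfl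
  have hidx0 : (⟨0, by omega⟩ : Fin (m + 2)) = 0 := rfl
  rw [hidx, hidx0]
  exact ⟨by linarith, by linarith, by linarith, by linarith⟩
end
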